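/- For all real numbers d and γ with 0 < d ≤ γ, one has ∫_0^{π/2} (√(γ² − d²·sin²θ) − d·cos θ)² dθ = γ²·arccos(d/γ) − d·√(γ² − d²). -/

import Mathlib

open Real

/-- Derivative of `u √(γ² − u²) + γ² arcsin (u/γ)`. -/
lemma aux_deriv (γ u : ℝ) (hγ : 0 < γ) (hu0 : 0 < u) (hu : u < γ) :
    HasDerivAt (fun u : ℝ => u * Real.sqrt (γ ^ 2 - u ^ 2) + γ ^ 2 * Real.arcsin (u / γ))
      (2 * Real.sqrt (γ ^ 2 - u ^ 2)) u := by
  have hpos : 0 < γ ^ 2 - u ^ 2 := by nlinarith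
  have hlt : u / γ < 1 := by rwa [div_lt_one hγ]
  have hgt : 0 < u / γ := by positivity
  have h1 : HasDerivAt (fun u : ℝ => Real.sqrt (γ ^ 2 - u ^ 2))
      ((-(2 * u)) / (2 * Real.sqrt (γ ^ 2 - u ^ 2))) u := by
    have h0 : HasDerivAt (fun u : ℝ => γ ^ 2 - u ^ 2) (-(2 * u)) u := by
      simpa using (hasDerivAt_pow 2 u).const_sub (γ ^ 2)
    exact h0.sqrt hpos.ne'
  have h2 : HasDerivAt (fun u : ℝ => Real.arcsin (u / γ))
      (1 / Real.sqrt (1 - (u / γ) ^ 2) * (1 / γ)) u :=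
    HasDerivAt.comp (h₂ := Real.arcsin) (h := fun u : ℝ => u / γ) u
      (Real.hasDerivAt_arcsin (by linarith) hlt.ne) ((hasDerivAt_id u).div_const γ)
  have h3 := ((hasDerivAt_id u).mul h1).add (h2.const_mul (γ ^ 2))
  have hs : Real.sqrt (1 - (u / γ) ^ 2) = Real.sqrt (γ ^ 2 - u ^ 2) / γ := by
    rw [show 1 - (u / γ) ^ 2 = (γ ^ 2 - u ^ 2) / γ ^ 2 by field_simp,
      Real.sqrt_div hpos.le, Real.sqrt_sq hγ.le]
  refine h3.congr_deriv ?_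
  have hsp := Real.sqrt_pos.mpr hpos
  have hsq := Real.sq_sqrt hpos.le
  rw [hs]
  simp only [id]
  generalize Real.sqrt (γ ^ 2 - u ^ 2) = s at *
  field_simp
  linarith

/-- For `0 < d ≤ γ`,
`∫₀^{π/2} (√(γ² − d² sin² θ) − d cos θ)² dθ = γ² arccos (d/γ) − d √(γ² − d²)`. -/
theorem distance_cdf_integral (d γ : ℝ) (hd : 0 < d) (hγ : d ≤ γ) :
    ∫ θ in (0:ℝ)..(π / 2),
        (Real.sqrt (γ ^ 2 - d ^ 2 * Real.sin θ ^ 2) - d * Real.cos θ) ^ 2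
      = γ ^ 2 * Real.arccos (d / γ) - d * Real.sqrt (γ ^ 2 - d ^ 2) := by
  have hγ0 : 0 < γ := by linarith
  have key := intervalIntegral.integral_eq_sub_of_hasDerivAt_of_le
    (f := fun θ : ℝ => γ ^ 2 * θ + d ^ 2 * (Real.sin θ * Real.cos θ) -
      ((d * Real.sin θ) * Real.sqrt (γ ^ 2 - (d * Real.sin θ) ^ 2)
        + γ ^ 2 * Real.arcsin ((d * Real.sin θ) / γ)))
    (f' := fun θ : ℝ => (Real.sqrt (γ ^ 2 - d ^ 2 * Real.sin θ ^ 2) - d * Real.cos θ) ^ 2)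
    (a := 0) (b := π / 2) (by positivity) ?_ ?_ ?_
  · rw [key, Real.arccos_eq_pi_div_two_sub_arcsin]
    simp
    ring
  · apply Continuous.continuousOn
    have := Real.continuous_arcsin
    fun_prop
  · intro θ hθ
    have hs0 : 0 < Real.sin θ := Real.sin_pos_of_pos_of_lt_pi hθ.1 (by linarith [hθ.2, Real.pi_pos])
    have hc0 : 0 < Real.cos θ := Real.cos_pos_of_mem_Ioo ⟨by linarith [hθ.1, Real.pi_pos], hθ.2⟩
    have hsc := Real.sin_sq_add_cos_sq θ
    have hs1 : Real.sin θ < 1 := by nlinarith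
    have hu : d * Real.sin θ < γ := by nlinarith
    have h1 := (aux_deriv γ (d * Real.sin θ) hγ0 (by positivity) hu).comp θ
      ((Real.hasDerivAt_sin θ).const_mul d)
    have h2 := (((hasDerivAt_id θ).const_mul (γ ^ 2)).add
      (((Real.hasDerivAt_sin θ).mul (Real.hasDerivAt_cos θ)).const_mul (d ^ 2))).sub h1
    refine h2.congr_deriv ?_
    have hpos : 0 ≤ γ ^ 2 - d ^ 2 * Real.sin θ ^ 2 := by
      have : 0 < d * Real.sin θ := by positivity
      nlinarith
    have hsq := Real.sq_sqrt hpos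
    rw [mul_pow]
    generalize Real.sqrt (γ ^ 2 - d ^ 2 * Real.sin θ ^ 2) = s at *
    linear_combination -hsq
  · apply Continuous.intervalIntegrable
    fun_prop
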